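/- Let T be a finite rooted binary tree with leaf assignment χ and maximum path decomposition P_max(T), let U be a connected component of the shrub forest of unsupported short paths, and let q be a child of p in U. Then |H_p| ≥ (3/2)|H_q|; moreover, if p ≠ r(U), then |H̃_p| ≥ (3/2)|H̃_q|. -/

import Mathlib

open scoped Classical
noncomputable section

/-- A finite rooted binary tree on vertex set `V`: every non-root vertex has a parent,
the root has none, depths are consistent (ensuring acyclicity), and each vertex has
at most two children. -/
structure RBTree (V : Type) [Fintype V] [DecidableEq V] where
  parent : V → Option V
  root : V
  depth : V → ℕ
  parent_root : parent root = none
  root_of_parent_none : ∀ v, parent v = none → v = root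
  depth_parent : ∀ v u, parent v = some u → depth v = depth u + 1
  binary : ∀ v : V, (Finset.univ.filter (fun c => parent c = some v)).card ≤ 2

namespace RBTree

variable {V : Type} [Fintype V] [DecidableEq V]

/-- The children of a vertex. -/
def children (T : RBTree V) (v : V) : Finset V :=
  Finset.univ.filter (fun c => T.parent c = some v)

/-- A leaf is a vertex with no children. -/
def IsLeaf (T : RBTree V) (v : V) : Prop := T.children v = ∅

/-- Iterated parent map. -/
def parentIter (T : RBTree V) : ℕ → V → Option V
  | 0, v => some v
  | n + 1, v => (T.parentIter n v).bind T.parent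

/-- `u` is a (weak) ancestor of `v`: `u` lies on the path from `v` to the root
(including `v` itself). -/
def Anc (T : RBTree V) (u v : V) : Prop := ∃ n, T.parentIter n v = some u

/-- `u` is a strict ancestor of `v`. -/
def StrictAnc (T : RBTree V) (u v : V) : Prop := ∃ n, 0 < n ∧ T.parentIter n v = some u

/-- `L(T_v)`: the leaves of the subtree rooted at `v`. -/
def subtreeLeaves (T : RBTree V) (v : V) : Finset V :=
  Finset.univ.filter (fun l => T.IsLeaf l ∧ T.Anc v l)

/-- A leaf assignment `χ` assigns to each internal vertex a set of leaves containing
exactly one leaf from the subtree of each of its children (and nothing else);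
leaves are assigned the empty set. -/
structure LeafAssignment (T : RBTree V) where
  χ : V → Finset V
  mem_leaf : ∀ v l, l ∈ χ v → T.IsLeaf l
  mem_desc : ∀ v l, l ∈ χ v → ∃ c ∈ T.children v, T.Anc c l
  unique_child : ∀ v, ∀ c ∈ T.children v, ∃! l, l ∈ χ v ∧ T.Anc c l

/-- The heap `H_v = {u ∈ A(v) : χ(u) ∩ L(T_v) ≠ ∅}` of a vertex `v`. -/
def heap (T : RBTree V) (A : T.LeafAssignment) (v : V) : Finset V :=
  Finset.univ.filter (fun u => T.StrictAnc u v ∧ (A.χ u ∩ T.subtreeLeaves v).Nonempty)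

/-- A leaf path: the set of vertices on a monotone path from some leaf `ℓ` up to an
ancestor `b` of `ℓ`. -/
def IsLeafPath (T : RBTree V) (p : Finset V) : Prop :=
  ∃ ℓ b, T.IsLeaf ℓ ∧ T.Anc b ℓ ∧
    p = Finset.univ.filter (fun u => T.Anc u ℓ ∧ T.Anc b u)

/-- The base `b(p)` of a path: its vertex closest to the root. -/
def base (T : RBTree V) (p : Finset V) : V :=
  if h : ∃ b, b ∈ p ∧ ∀ w ∈ p, T.Anc b w then h.choose else T.root

/-- The leaf `ℓ(p)` of a path. -/
def pathLeaf (T : RBTree V) (p : Finset V) : V :=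
  if h : ∃ l, l ∈ p ∧ ∀ w ∈ p, T.Anc w l then h.choose else T.root

/-- `H_p = H_{b(p)}`. -/
def pathHeap (T : RBTree V) (A : T.LeafAssignment) (p : Finset V) : Finset V :=
  T.heap A (T.base p)

/-- A path decomposition: a partition of the vertex set into leaf paths. -/
def IsPathDecomp (T : RBTree V) (P : Finset (Finset V)) : Prop :=
  (∀ p ∈ P, T.IsLeafPath p) ∧ (∀ v : V, ∃! p, p ∈ P ∧ v ∈ p)

/-- `q` is a child of `p` in the shrub: the parent of `b(q)` lies on `p`. -/
def ShrubParent (T : RBTree V) (p q : Finset V) : Prop :=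
  ∃ u, T.parent (T.base q) = some u ∧ u ∈ p

/-- `p` is a strict ancestor of `q` in the shrub: some vertex of `p` is a strict
ancestor of `b(q)` in `T` (and `p ≠ q`). -/
def ShrubStrictAnc (T : RBTree V) (p q : Finset V) : Prop :=
  p ≠ q ∧ ∃ u ∈ p, T.StrictAnc u (T.base q)

/-- Weak ancestor relation in the shrub. -/
def ShrubAnc (T : RBTree V) (p q : Finset V) : Prop :=
  p = q ∨ T.ShrubStrictAnc p q

/-- A maximum path decomposition w.r.t. a leaf assignment: a path decomposition in
which each internal vertex lies on the same path as a child of maximal heap size. -/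
def IsMaxPathDecomp (T : RBTree V) (A : T.LeafAssignment) (P : Finset (Finset V)) : Prop :=
  T.IsPathDecomp P ∧
    ∀ p ∈ P, ∀ v ∈ p, ∀ c ∈ T.children v, c ∈ p →
      ∀ c' ∈ T.children v, (T.heap A c').card ≤ (T.heap A c).card

/-- A path `p` is short if `|p| < sqrt(|H_p|)/100`. -/
def IsShort (T : RBTree V) (A : T.LeafAssignment) (p : Finset V) : Prop :=
  (p.card : ℝ) < Real.sqrt ((T.pathHeap A p).card) / 100

/-- The tall support chain of a path `p`: the maximal chain of tall paths in the shrub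
starting at the parent of `p` and going up. -/
def TallChain (T : RBTree V) (A : T.LeafAssignment) (P : Finset (Finset V)) (p : Finset V) :
    Finset (Finset V) :=
  P.filter (fun q => T.ShrubStrictAnc q p ∧
    ∀ r ∈ P, T.ShrubStrictAnc r p → T.ShrubAnc q r → ¬ T.IsShort A r)

/-- A short path is supported if at least `|H_p|/100` of the vertices of `H_p` lie on
paths of its tall support chain. -/
def IsSupported (T : RBTree V) (A : T.LeafAssignment) (P : Finset (Finset V))
    (p : Finset V) : Prop :=
  ((T.pathHeap A p).card : ℝ) / 100 ≤
    (((T.pathHeap A p).filter (fun v => ∃ q ∈ T.TallChain A P p, v ∈ q)).card : ℝ)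

/-- The reduced heap `H̃_p`: vertices of `H_p` not lying on the tall support chain. -/
def redHeap (T : RBTree V) (A : T.LeafAssignment) (P : Finset (Finset V))
    (p : Finset V) : Finset V :=
  (T.pathHeap A p).filter (fun v => ∀ q ∈ T.TallChain A P p, v ∉ q)

/-- `q` is the parent of the unsupported short path `p` in the shrub forest of
unsupported short paths: `q` is the first short path on the chain of strict shrub
ancestors of `p`. -/
def ForestParent (T : RBTree V) (A : T.LeafAssignment) (P : Finset (Finset V))
    (q p : Finset V) : Prop :=
  q ∈ P ∧ p ∈ P ∧ T.IsShort A q ∧ T.IsShort A p ∧ ¬ T.IsSupported A P p ∧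
    T.ShrubStrictAnc q p ∧
    ∀ r ∈ P, T.ShrubStrictAnc r p → T.ShrubStrictAnc q r → ¬ T.IsShort A r

/-- `U` is the connected component of the shrub forest of unsupported short paths
rooted at the supported short path `r`. -/
def IsComponent (T : RBTree V) (A : T.LeafAssignment) (P : Finset (Finset V))
    (U : Finset (Finset V)) (r : Finset V) : Prop :=
  U ⊆ P ∧ r ∈ U ∧ T.IsShort A r ∧ T.IsSupported A P r ∧
    (∀ p ∈ U, T.IsShort A p) ∧
    (∀ p ∈ U, p ≠ r → ¬ T.IsSupported A P p) ∧
    (∀ p ∈ U, p ≠ r → ∃ q ∈ U, T.ForestParent A P q p) ∧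
    (∀ q ∈ U, ∀ p ∈ P, T.ForestParent A P q p → p ∈ U)

/-- `q` lies in the subtree of the shrub forest rooted at `p`. -/
def ForestDesc (T : RBTree V) (A : T.LeafAssignment) (P : Finset (Finset V))
    (p q : Finset V) : Prop :=
  Relation.ReflTransGen (fun a b => T.ForestParent A P a b) p q

/-- `U_p`: the nodes of `U` in the subtree of the shrub forest rooted at `p`. -/
def usub (T : RBTree V) (A : T.LeafAssignment) (P : Finset (Finset V))
    (U : Finset (Finset V)) (p : Finset V) : Finset (Finset V) :=
  U.filter (fun q => T.ForestDesc A P p q)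

/-- The children of `p` in the shrub forest (within `U`). -/
def forestChildren (T : RBTree V) (A : T.LeafAssignment) (P : Finset (Finset V))
    (U : Finset (Finset V)) (p : Finset V) : Finset (Finset V) :=
  U.filter (fun q => T.ForestParent A P p q)

/-- The residue `R_p = |H̃_p| − Σ_{q child of p} |H̃_q|`. -/
def residue (T : RBTree V) (A : T.LeafAssignment) (P : Finset (Finset V))
    (U : Finset (Finset V)) (p : Finset V) : ℤ :=
  ((T.redHeap A P p).card : ℤ) -
    ∑ q ∈ T.forestChildren A P U p, ((T.redHeap A P q).card : ℤ)

/-- `R⁺_p = max(R_p, 0)`. -/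
def resPlus (T : RBTree V) (A : T.LeafAssignment) (P : Finset (Finset V))
    (U : Finset (Finset V)) (p : Finset V) : ℤ :=
  max (T.residue A P U p) 0

/-- The weight `W_p = Σ_{q ∈ U_p} R⁺_q`. -/
def weight (T : RBTree V) (A : T.LeafAssignment) (P : Finset (Finset V))
    (U : Finset (Finset V)) (p : Finset V) : ℤ :=
  ∑ q ∈ T.usub A P U p, T.resPlus A P U q

end RBTree

namespace RBTree

section Ancestors

variable {V : Type} [Fintype V] [DecidableEq V] (T : RBTree V)

theorem parentIter_add (m n : ℕ) (v : V) :
    T.parentIter (m + n) v = (T.parentIter m v).bind (T.parentIter n) := by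
  induction n with
  | zero => cases T.parentIter m v <;> simp [parentIter]
  | succ n ih =>
    rw [← Nat.add_assoc, parentIter, ih]
    cases T.parentIter m v <;> simp [parentIter]

theorem depth_of_parentIter {n : ℕ} {v u : V} (h : T.parentIter n v = some u) :
    T.depth v = T.depth u + n := by
  induction n generalizing u with
  | zero => simp_all [parentIter]
  | succ n ih =>
    rw [parentIter, Option.bind_eq_some_iff] at h
    obtain ⟨w, hw, hwu⟩ := h
    have h1 := ih hw
    have h2 := T.depth_parent w u hwu
    omega

variable {T}

theorem Anc.refl (v : V) : T.Anc v v := ⟨0, rfl⟩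

theorem Anc.trans {a b c : V} (hab : T.Anc a b) (hbc : T.Anc b c) : T.Anc a c := by
  obtain ⟨n, hn⟩ := hab
  obtain ⟨m, hm⟩ := hbc
  exact ⟨m + n, by rw [parentIter_add, hm]; exact hn⟩

theorem Anc.depth_le {a b : V} (h : T.Anc a b) : T.depth a ≤ T.depth b := by
  obtain ⟨n, hn⟩ := h
  have := T.depth_of_parentIter hn
  omega

theorem strictAnc_iff {a b : V} : T.StrictAnc a b ↔ T.Anc a b ∧ T.depth a < T.depth b := by
  constructor
  · rintro ⟨n, hn, h⟩
    have := T.depth_of_parentIter h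
    exact ⟨⟨n, h⟩, by omega⟩
  · rintro ⟨⟨n, h⟩, hlt⟩
    have := T.depth_of_parentIter h
    exact ⟨n, by omega, h⟩

theorem Anc.of_depth_le {a b w : V} (ha : T.Anc a w) (hb : T.Anc b w)
    (h : T.depth a ≤ T.depth b) : T.Anc a b := by
  obtain ⟨n, hn⟩ := ha
  obtain ⟨m, hm⟩ := hb
  have h1 := T.depth_of_parentIter hn
  have h2 := T.depth_of_parentIter hm
  obtain ⟨k, rfl⟩ : ∃ k, n = m + k := ⟨n - m, by omega⟩
  rw [parentIter_add, hm] at hn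
  exact ⟨k, hn⟩

theorem Anc.eq_of_depth_le {a b : V} (h : T.Anc a b) (hd : T.depth b ≤ T.depth a) : a = b := by
  obtain ⟨n, hn⟩ := h
  have h1 := T.depth_of_parentIter hn
  obtain rfl : n = 0 := by omega
  simpa [parentIter, eq_comm] using hn

theorem anc_of_mem_children {v c : V} (h : c ∈ T.children v) : T.Anc v c :=
  ⟨1, by simpa [children, parentIter] using h⟩

theorem depth_of_mem_children {v c : V} (h : c ∈ T.children v) :
    T.depth c = T.depth v + 1 :=
  T.depth_parent c v (by simpa [children] using h)

theorem StrictAnc.exists_child {u w : V} (h : T.StrictAnc u w) :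
    ∃ c ∈ T.children u, T.Anc c w := by
  obtain ⟨n, hn, h⟩ := h
  obtain ⟨m, rfl⟩ : ∃ m, n = m + 1 := ⟨n - 1, by omega⟩
  rw [parentIter, Option.bind_eq_some_iff] at h
  obtain ⟨c, hc, hcu⟩ := h
  exact ⟨c, by simpa [children] using hcu, m, hc⟩

end Ancestors

section LeafPaths

variable {V : Type} [Fintype V] [DecidableEq V] {T : RBTree V} {p : Finset V}

theorem IsLeafPath.base_spec (hp : T.IsLeafPath p) :
    T.base p ∈ p ∧ ∀ w ∈ p, T.Anc (T.base p) w := by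
  have h : ∃ b, b ∈ p ∧ ∀ w ∈ p, T.Anc b w := by
    obtain ⟨l, b, -, hbl, rfl⟩ := hp
    exact ⟨b, by simpa using ⟨hbl, Anc.refl b⟩, fun w hw => by simp_all⟩
  rw [base, dif_pos h]
  exact h.choose_spec

theorem IsLeafPath.mem_of_anc_of_anc (hp : T.IsLeafPath p) {a w b : V} (ha : a ∈ p) (hb : b ∈ p)
    (haw : T.Anc a w) (hwb : T.Anc w b) : w ∈ p := by
  obtain ⟨l, t, -, -, rfl⟩ := hp
  simp only [Finset.mem_filter, Finset.mem_univ, true_and] at *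
  exact ⟨hwb.trans hb.1, ha.2.trans haw⟩

theorem IsLeafPath.exists_child_mem (hp : T.IsLeafPath p) {v c' : V} (hv : v ∈ p)
    (hc' : c' ∈ T.children v) : ∃ c ∈ T.children v, c ∈ p := by
  obtain ⟨l, b, hl, hbl, rfl⟩ := hp
  simp only [Finset.mem_filter, Finset.mem_univ, true_and] at *
  have hne : v ≠ l := by
    rintro rfl
    rw [IsLeaf] at hl
    simp [hl] at hc'
  have hlt : T.depth v < T.depth l := by
    by_contra h
    exact hne (hv.1.eq_of_depth_le (not_lt.1 h))
  obtain ⟨c, hc, hcl⟩ := (strictAnc_iff.2 ⟨hv.1, hlt⟩).exists_child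
  exact ⟨c, hc, hcl, hv.2.trans (anc_of_mem_children hc)⟩

end LeafPaths

section Heaps

variable {V : Type} [Fintype V] [DecidableEq V] {T : RBTree V}

theorem subtreeLeaves_mono {a b : V} (h : T.Anc a b) :
    T.subtreeLeaves b ⊆ T.subtreeLeaves a := by
  intro l hl
  simp only [subtreeLeaves, Finset.mem_filter, Finset.mem_univ, true_and] at *
  exact ⟨hl.1, h.trans hl.2⟩

theorem mem_heap {A : T.LeafAssignment} {u v : V} :
    u ∈ T.heap A v ↔ T.StrictAnc u v ∧ (A.χ u ∩ T.subtreeLeaves v).Nonempty := by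
  simp [heap]

theorem mem_heap_of_anc {A : T.LeafAssignment} {u a b : V} (h : T.Anc a b)
    (hu : u ∈ T.heap A b) (hua : T.StrictAnc u a) : u ∈ T.heap A a :=
  mem_heap.2 ⟨hua, (mem_heap.1 hu).2.mono
    (Finset.inter_subset_inter_left (subtreeLeaves_mono h))⟩

/-- The heaps of two siblings share at most their parent. -/
theorem heap_inter_heap_subset (A : T.LeafAssignment) {v c c' : V} (hc : c ∈ T.children v)
    (hc' : c' ∈ T.children v) (hne : c ≠ c') : T.heap A c ∩ T.heap A c' ⊆ {v} := by
  intro u hu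
  rw [Finset.mem_inter, mem_heap, mem_heap] at hu
  obtain ⟨⟨huc, l, hl⟩, huc', l', hl'⟩ := hu
  simp only [subtreeLeaves, Finset.mem_inter, Finset.mem_filter, Finset.mem_univ,
    true_and] at hl hl'
  rw [strictAnc_iff] at huc
  have hdc := depth_of_mem_children hc
  have hdc' := depth_of_mem_children hc'
  have huv : T.Anc u v := huc.1.of_depth_le (anc_of_mem_children hc) (by omega)
  rw [Finset.mem_singleton]
  by_contra hne'
  have hlt : T.depth u < T.depth v := by
    by_contra h
    exact hne' (huv.eq_of_depth_le (not_lt.1 h))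
  obtain ⟨d, hd, hdv⟩ := (strictAnc_iff.2 ⟨huv, hlt⟩).exists_child
  have hll : l = l' := (A.unique_child u d hd).unique
    ⟨hl.1, (hdv.trans (anc_of_mem_children hc)).trans hl.2.2⟩
    ⟨hl'.1, (hdv.trans (anc_of_mem_children hc')).trans hl'.2.2⟩
  subst hll
  have hcc' : T.Anc c c' := hl.2.2.of_depth_le hl'.2.2 (by omega)
  exact hne (hcc'.eq_of_depth_le (by omega))

theorem heap_subset_pathHeap_union (A : T.LeafAssignment) {p : Finset V} (hp : T.IsLeafPath p)
    {v c : V} (hv : v ∈ p) (hc : c ∈ T.children v) :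
    T.heap A c ⊆ T.pathHeap A p ∪ p := by
  intro u hu
  obtain ⟨hbp, hb⟩ := hp.base_spec
  have huc := strictAnc_iff.1 (mem_heap.1 hu).1
  have hvc := anc_of_mem_children hc
  have hdc := depth_of_mem_children hc
  have hbc := (hb v hv).trans hvc
  rw [Finset.mem_union]
  by_cases h : T.depth (T.base p) ≤ T.depth u
  · exact .inr (hp.mem_of_anc_of_anc hbp hv (hbc.of_depth_le huc.1 h)
      (huc.1.of_depth_le hvc (by omega)))
  · push Not at h
    exact .inl (mem_heap_of_anc hbc hu (strictAnc_iff.2 ⟨huc.1.of_depth_le hbc h.le, h⟩))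

theorem card_heap_add_card_heap_le (A : T.LeafAssignment) {p : Finset V} (hp : T.IsLeafPath p)
    {v c c' : V} (hv : v ∈ p) (hc : c ∈ T.children v) (hc' : c' ∈ T.children v) (hne : c ≠ c') :
    (T.heap A c).card + (T.heap A c').card ≤ (T.pathHeap A p).card + 2 * p.card := by
  have h1 := Finset.card_union_add_card_inter (T.heap A c) (T.heap A c')
  have h2 := Finset.card_le_card (heap_inter_heap_subset A hc hc' hne)
  have h3 := Finset.card_le_card (Finset.union_subset
    (heap_subset_pathHeap_union A hp hv hc) (heap_subset_pathHeap_union A hp hv hc'))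
  have h4 := Finset.card_union_le (T.pathHeap A p) p
  have h5 : 0 < p.card := Finset.card_pos.2 ⟨v, hv⟩
  rw [Finset.card_singleton] at h2
  omega

end Heaps

section Forest

variable {V : Type} [Fintype V] [DecidableEq V] {T : RBTree V} {A : T.LeafAssignment}
  {P : Finset (Finset V)} {p q : Finset V}

theorem IsPathDecomp.eq_of_mem (hP : T.IsPathDecomp P) {v : V} (hp : p ∈ P) (hq : q ∈ P)
    (hvp : v ∈ p) (hvq : v ∈ q) : p = q :=
  (hP.2 v).unique ⟨hp, hvp⟩ ⟨hq, hvq⟩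

/-- A shrub ancestor `p` of `q` is left towards `q` through an edge from a vertex of `p` to a
child outside `p`. -/
theorem IsPathDecomp.exists_exit (hP : T.IsPathDecomp P) (hp : p ∈ P) (hq : q ∈ P)
    (h : T.ShrubStrictAnc p q) :
    ∃ v ∈ p, ∃ c ∈ T.children v, c ∉ p ∧ T.Anc c (T.base q) := by
  obtain ⟨hne, u, hup, hu⟩ := h
  obtain ⟨v, hv, hmax⟩ := (p.filter fun w => T.Anc w (T.base q)).exists_max_image T.depth
    ⟨u, Finset.mem_filter.2 ⟨hup, (strictAnc_iff.1 hu).1⟩⟩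
  rw [Finset.mem_filter] at hv
  have hbq : T.base q ∉ p := fun hb =>
    hne (hP.eq_of_mem hp hq hb (hP.1 q hq).base_spec.1)
  have hlt : T.depth v < T.depth (T.base q) := by
    by_contra h
    exact hbq (hv.2.eq_of_depth_le (not_lt.1 h) ▸ hv.1)
  obtain ⟨c, hc, hcq⟩ := (strictAnc_iff.2 ⟨hv.2, hlt⟩).exists_child
  refine ⟨v, hv.1, c, hc, fun hcp => ?_, hcq⟩
  have h1 := hmax c (Finset.mem_filter.2 ⟨hcp, hcq⟩)
  have h2 := depth_of_mem_children hc
  omega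

/-- The vertices strictly between the forest parent `p` of `q` and `q` lie on the tall support
chain of `q`. -/
theorem ForestParent.exists_mem_tallChain (hP : T.IsPathDecomp P) (hpq : T.ForestParent A P p q)
    {v c u : V} (hv : v ∈ p) (hc : c ∈ T.children v) (hcp : c ∉ p) (hcu : T.Anc c u)
    (hu : T.StrictAnc u (T.base q)) : ∃ x ∈ T.TallChain A P q, u ∈ x := by
  obtain ⟨hp, hq, -, -, -, -, hfirst⟩ := hpq
  obtain ⟨x, ⟨hx, hux⟩, -⟩ := hP.2 u
  have hvc := anc_of_mem_children hc
  have hdc := depth_of_mem_children hc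
  obtain ⟨hbx, hbxmin⟩ := (hP.1 x hx).base_spec
  have hup : u ∉ p := fun hup => hcp ((hP.1 p hp).mem_of_anc_of_anc hv hup hvc hcu)
  have hpx : p ≠ x := by rintro rfl; exact hup hux
  have hvx : T.StrictAnc v (T.base x) := by
    have hvu := hvc.trans hcu
    by_cases h : T.depth v < T.depth (T.base x)
    · exact strictAnc_iff.2 ⟨hvu.of_depth_le (hbxmin u hux) h.le, h⟩
    · exact absurd (hP.eq_of_mem hp hx hv ((hP.1 x hx).mem_of_anc_of_anc hbx hux
        ((hbxmin u hux).of_depth_le hvu (not_lt.1 h)) hvu)) hpx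
  refine ⟨x, Finset.mem_filter.2 ⟨hx, ⟨?_, u, hux, hu⟩, fun r hr hrq hxr => ?_⟩, hux⟩
  · rintro rfl
    have h1 := (hbxmin u hux).depth_le
    have h2 := (strictAnc_iff.1 hu).2
    omega
  · refine hfirst r hr hrq ?_
    obtain rfl | ⟨-, w, hwx, hw⟩ := hxr
    · exact ⟨hpx, v, hv, hvx⟩
    · rw [strictAnc_iff] at hw hvx
      have hxw := hbxmin w hwx
      have hlt : T.depth v < T.depth (T.base r) := by
        have := hxw.depth_le
        omega
      refine ⟨?_, v, hv, strictAnc_iff.2 ⟨(hvx.1.trans hxw).trans hw.1, hlt⟩⟩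
      rintro rfl
      have := ((hP.1 p hp).base_spec.2 v hv).depth_le
      omega

theorem card_filter_tallChain_add_card_redHeap :
    ((T.pathHeap A p).filter (fun v => ∃ x ∈ T.TallChain A P p, v ∈ x)).card +
      (T.redHeap A P p).card = (T.pathHeap A p).card := by
  rw [redHeap, ← Finset.card_filter_add_card_filter_not (s := T.pathHeap A p)
    (fun v => ∃ x ∈ T.TallChain A P p, v ∈ x)]
  simp

theorem ForestParent.redHeap_subset_heap (hP : T.IsPathDecomp P) (hpq : T.ForestParent A P p q)
    {v c : V} (hv : v ∈ p) (hc : c ∈ T.children v) (hcp : c ∉ p) (hcq : T.Anc c (T.base q)) :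
    T.redHeap A P q ⊆ T.heap A c := by
  intro u hu
  rw [redHeap, Finset.mem_filter] at hu
  obtain ⟨huq, hut⟩ := hu
  have hanc := (mem_heap.1 huq).1
  have hanc' := (strictAnc_iff.1 hanc).1
  refine mem_heap_of_anc hcq huq ?_
  by_cases h : T.depth u < T.depth c
  · exact strictAnc_iff.2 ⟨hanc'.of_depth_le hcq h.le, h⟩
  · obtain ⟨x, hx, hux⟩ := hpq.exists_mem_tallChain hP hv hc hcp
      (hcq.of_depth_le hanc' (not_lt.1 h)) hanc
    exact absurd hux (hut x hx)

theorem ForestParent.two_mul_card_redHeap_le (hP : T.IsMaxPathDecomp A P)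
    (hpq : T.ForestParent A P p q) :
    2 * (T.redHeap A P q).card ≤ (T.pathHeap A p).card + 2 * p.card := by
  have hp := hpq.1
  obtain ⟨v, hv, c', hc', hc'p, hc'q⟩ := hP.1.exists_exit hp hpq.2.1 hpq.2.2.2.2.2.1
  obtain ⟨c, hc, hcp⟩ := (hP.1.1 p hp).exists_child_mem hv hc'
  have hne : c ≠ c' := by rintro rfl; exact hc'p hcp
  have h1 := hP.2 p hp v hv c hc hcp c' hc'
  have h2 := card_heap_add_card_heap_le A (hP.1.1 p hp) hv hc hc' hne
  have h3 := Finset.card_le_card (hpq.redHeap_subset_heap hP.1 hv hc' hc'p hc'q)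
  omega

theorem card_redHeap_gt_of_not_isSupported (h : ¬ T.IsSupported A P p) :
    (99 / 100 : ℝ) * (T.pathHeap A p).card < (T.redHeap A P p).card := by
  rw [IsSupported, not_le] at h
  have h1 : (_ : ℝ) = _ := congrArg Nat.cast
    (card_filter_tallChain_add_card_redHeap (T := T) (A := A) (P := P) (p := p))
  push_cast at h1
  linarith

theorem IsShort.card_le (h : T.IsShort A p) :
    (p.card : ℝ) ≤ (T.pathHeap A p).card / 100 := by
  have hsqrt : Real.sqrt ((T.pathHeap A p).card : ℝ) ≤ (T.pathHeap A p).card := by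
    rw [Real.sqrt_le_left (Nat.cast_nonneg _)]
    exact_mod_cast Nat.le_self_pow two_ne_zero _
  rw [IsShort] at h
  linarith

end Forest

end RBTree

open RBTree in
/-- for a connected component `U` (with root `r`) of the shrub forest of
unsupported short paths of a maximum path decomposition, if `q` is a child of `p` in `U`,
then `|H_p| ≥ (3/2)|H_q|`; moreover if `p ≠ r(U)` then `|H̃_p| ≥ (3/2)|H̃_q|`. -/
theorem forest_heap_geometric {V : Type} [Fintype V] [DecidableEq V]
    (T : RBTree V) (A : T.LeafAssignment) (P : Finset (Finset V))
    (hP : T.IsMaxPathDecomp A P) (U : Finset (Finset V)) (r : Finset V)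
    (hU : T.IsComponent A P U r) (p q : Finset V) (hpU : p ∈ U) (hqU : q ∈ U)
    (hpq : T.ForestParent A P p q) :
    (3 / 2 : ℝ) * ((T.pathHeap A q).card : ℝ) ≤ ((T.pathHeap A p).card : ℝ) ∧
      (p ≠ r →
        (3 / 2 : ℝ) * ((T.redHeap A P q).card : ℝ) ≤ ((T.redHeap A P p).card : ℝ)) := by
  have h1 : (2 : ℝ) * (T.redHeap A P q).card ≤ (T.pathHeap A p).card + 2 * p.card := by
    exact_mod_cast hpq.two_mul_card_redHeap_le hP
  have h2 := hpq.2.2.1.card_le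
  have h3 := card_redHeap_gt_of_not_isSupported hpq.2.2.2.2.1
  have h4 : ((T.redHeap A P q).card : ℝ) ≤ (T.pathHeap A q).card := by
    exact_mod_cast Finset.card_filter_le _ _
  refine ⟨by linarith, fun hpr => ?_⟩
  have h5 := card_redHeap_gt_of_not_isSupported (hU.2.2.2.2.2.1 p hpU hpr)
  linarith
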